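/- arXiv:0710.1816 — 2 statements merged into one kernel-verified Lean document; each statement's English description precedes it below -/
import Mathlib

section
/- Let G be an abelian group, let α, β ∈ G, and let λ and π be nonempty set partitions (of [n] and [n'] respectively). If the multisets s_{α,β}(T(λ,l)) and s_{β,α}(T(π,l)) are equal for l = 0 and l = 1, then the multisets s_{α,β}(T(λ,l,m)) and s_{β,α}(T(π,l,m)) are equal for all l, m ≥ 0. -/
open Finset

/-- A set partition of `[n] = {1,…,n}`, modeled as a `Finpartition` of `Fin n`. -/
abbrev SetPartition (n : ℕ) := Finpartition (Finset.univ : Finset (Fin n))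

/-- `(i,j)` is an arc of the partition `p`: `i < j`, they lie in a common block,
and no element of that block lies strictly between them. -/
def IsArc {n : ℕ} (p : SetPartition n) (i j : Fin n) : Prop :=
  i < j ∧ ∃ B ∈ p.parts, i ∈ B ∧ j ∈ B ∧ ∀ x ∈ B, ¬ (i < x ∧ x < j)

/-- Arcs `a = (i₁,j₁)` and `b = (i₂,j₂)` form a crossing: `i₁ < i₂ < j₁ < j₂`. -/
def Crossing {n : ℕ} (a b : Fin n × Fin n) : Prop :=
  a.1 < b.1 ∧ b.1 < a.2 ∧ a.2 < b.2

/-- Arcs `a = (i₁,j₁)` and `b = (i₂,j₂)` form a nesting: `i₁ < i₂ < j₂ < j₁`. -/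
def Nesting {n : ℕ} (a b : Fin n × Fin n) : Prop :=
  a.1 < b.1 ∧ b.1 < b.2 ∧ b.2 < a.2

/-- `cr p`: the number of crossings of two arcs in `p`. -/
noncomputable def cr {n : ℕ} (p : SetPartition n) : ℕ :=
  {e : (Fin n × Fin n) × (Fin n × Fin n) |
    IsArc p e.1.1 e.1.2 ∧ IsArc p e.2.1 e.2.2 ∧ Crossing e.1 e.2}.ncard

/-- `ne' p`: the number of nestings of two arcs in `p`. -/
noncomputable def ne' {n : ℕ} (p : SetPartition n) : ℕ :=
  {e : (Fin n × Fin n) × (Fin n × Fin n) |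
    IsArc p e.1.1 e.1.2 ∧ IsArc p e.2.1 e.2.2 ∧ Nesting e.1 e.2}.ncard

/-- `al p`: the number of alignments (unordered pairs of arcs that neither
cross nor nest, counted with first endpoints in increasing order). -/
noncomputable def al {n : ℕ} (p : SetPartition n) : ℕ :=
  {e : (Fin n × Fin n) × (Fin n × Fin n) |
    IsArc p e.1.1 e.1.2 ∧ IsArc p e.2.1 e.2.2 ∧ e.1.1 < e.2.1 ∧
    ¬ Crossing e.1 e.2 ∧ ¬ Crossing e.2 e.1 ∧
    ¬ Nesting e.1 e.2 ∧ ¬ Nesting e.2 e.1}.ncard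

/-- `i` and `j` lie in a common block of `p`. -/
def InSameBlock {n : ℕ} (p : SetPartition n) (i j : Fin n) : Prop :=
  ∃ B ∈ p.parts, i ∈ B ∧ j ∈ B

/-- `c` (a partition of `[n+1]`) is a child of `p` (a partition of `[n]`):
deleting the element `1` from `c` and shifting down by one yields `p`. -/
def IsChild {n : ℕ} (c : SetPartition (n + 1)) (p : SetPartition n) : Prop :=
  ∀ i j : Fin n, (InSameBlock p i j ↔ InSameBlock c i.succ j.succ)

/-- `level p l` is `T(p, l)`: the set of partitions of `[n+l]` at the `l`-th level of
the subtree rooted at `p` in the tree of partitions. -/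
def level {n : ℕ} (p : SetPartition n) : (l : ℕ) → Set (SetPartition (n + l))
  | 0 => {p}
  | l + 1 => {c | ∃ q ∈ level p l, IsChild c q}

/-- The statistic `s_{α,β}(p) = cr(p)·α + ne(p)·β`. -/
noncomputable def statS {G : Type*} [AddCommGroup G] (α β : G) {n : ℕ} (p : SetPartition n) : G :=
  cr p • α + ne' p • β



/-- The sum of `f u a v` over all ways of writing a list as `u ++ a :: v`. -/
def splitSum {ι R : Type*} [AddCommMonoid R] : (List ι → ι → List ι → R) → List ι → R
  | _, [] => 0
  | f, a :: v => f [] a v + splitSum (fun u => f (a :: u)) v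

section SplitSum

variable {ι κ R : Type*} [AddCommMonoid R]

theorem splitSum_append (f : List ι → ι → List ι → R) (x y : List ι) :
    splitSum f (x ++ y) =
      splitSum (fun u a w => f u a (w ++ y)) x + splitSum (fun u => f (x ++ u)) y := by
  induction x generalizing f with
  | nil => simp [splitSum]
  | cons a x ih => simp [splitSum, ih, add_assoc]

theorem splitSum_reverse (f : List ι → ι → List ι → R) (x : List ι) :
    splitSum f x.reverse = splitSum (fun u a w => f w.reverse a u.reverse) x := by
  induction x generalizing f with
  | nil => simp [splitSum]
  | cons a x ih => simp [splitSum, splitSum_append, ih, add_comm]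

theorem splitSum_map (g : κ → ι) (f : List ι → ι → List ι → R) (x : List κ) :
    splitSum f (x.map g) = splitSum (fun u a w => f (u.map g) (g a) (w.map g)) x := by
  induction x generalizing f with
  | nil => simp [splitSum]
  | cons a x ih => simp [splitSum, ih]

theorem splitSum_eq_sum (f : List ι → ι → List ι → R) (g : ι → R) (x : List ι)
    (h : ∀ u a w, x = u ++ a :: w → f u a w = g a) : splitSum f x = (x.map g).sum := by
  induction x generalizing f with
  | nil => simp [splitSum]
  | cons a x ih =>
    simp only [splitSum, List.map_cons, List.sum_cons]
    rw [h [] a x rfl, ih _ fun u b w hx => h (a :: u) b w (by simp [hx])]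

end SplitSum

/-- A function on a commutative semiring of the form `q ↦ A + q * B`. -/
def IsAffine {R : Type*} [CommSemiring R] (f : R → R) : Prop :=
  ∃ A B : R, ∀ q, f q = A + q * B

section Affine

variable {R : Type*} [CommSemiring R]

theorem IsAffine.add {f g : R → R} (hf : IsAffine f) (hg : IsAffine g) :
    IsAffine fun q => f q + g q := by
  obtain ⟨A, B, hf⟩ := hf
  obtain ⟨C, D, hg⟩ := hg
  exact ⟨A + C, B + D, fun q => by simp only [hf, hg]; ring⟩

theorem IsAffine.const_mul {f : R → R} (hf : IsAffine f) (c : R) :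
    IsAffine fun q => c * f q := by
  obtain ⟨A, B, hf⟩ := hf
  exact ⟨c * A, c * B, fun q => by simp only [hf]; ring⟩

theorem IsAffine.comp_mul {f : R → R} (hf : IsAffine f) (c : R) :
    IsAffine fun q => f (c * q) := by
  obtain ⟨A, B, hf⟩ := hf
  exact ⟨A, c * B, fun q => by simp only [hf]; ring⟩

theorem IsAffine.splitSum {ι : Type*} {f : R → List ι → ι → List ι → R}
    (hf : ∀ u a w, IsAffine fun q => f q u a w) (x : List ι) :
    IsAffine fun q => splitSum (f q) x := by
  induction x generalizing f with
  | nil => exact ⟨0, 0, fun q => by simp [_root_.splitSum]⟩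
  | cons a x ih => exact (hf _ _ _).add (ih fun u => hf (a :: u))

end Affine

/-- The generating function of the `l`-th level of the tree below a partition whose block minima
carry the weights `x`: a new singleton contributes a factor `t`, and joining the block of weight
`p` contributes `p` and multiplies the weights before it by `a` and those after it by `b`. -/
def treeSum {R : Type*} [CommSemiring R] (t a b : R) : ℕ → List R → R
  | 0, _ => 1
  | l + 1, x => t * treeSum t a b l (1 :: x) +
      splitSum (fun u p v => p * treeSum t a b l (1 :: (u.map (a * ·) ++ v.map (b * ·)))) x

section TreeSum

variable {R : Type*} [CommSemiring R] (t a b : R)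

theorem isAffine_treeSum (l : ℕ) (u v : List R) :
    IsAffine fun q => treeSum t a b l (u ++ q :: v) := by
  induction l generalizing u v with
  | zero => exact ⟨1, 0, fun q => by simp [treeSum]⟩
  | succ l ih =>
    simp only [treeSum, splitSum_append, splitSum]
    refine ((ih (1 :: u) v).const_mul t).add (IsAffine.add ?_ (IsAffine.add ?_ ?_))
    · refine IsAffine.splitSum (fun u' p w => ?_) u
      have := ((ih (1 :: (u'.map (a * ·) ++ w.map (b * ·))) (v.map (b * ·))).comp_mul b).const_mul p
      simpa using this
    · exact ⟨0, _, fun q => (zero_add _).symm⟩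
    · refine IsAffine.splitSum (fun u' p w => ?_) v
      have := ((ih (1 :: u.map (a * ·)) (u'.map (a * ·) ++ w.map (b * ·))).comp_mul a).const_mul p
      simpa using this

theorem List.Perm.eq_of_append_swap {ι β : Type*} {f : List ι → β}
    (hf : ∀ u p q v, f (u ++ p :: q :: v) = f (u ++ q :: p :: v)) {x y : List ι}
    (h : x.Perm y) : f x = f y := by
  suffices ∀ u, f (u ++ x) = f (u ++ y) from this []
  induction h with
  | nil => exact fun _ => rfl
  | cons a _ ih => exact fun u => by simpa using ih (u ++ [a])
  | swap p q v => exact fun u => hf u q p v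
  | trans _ _ ih₁ ih₂ => exact fun u => (ih₁ u).trans (ih₂ u)

theorem treeSum_perm (l : ℕ) {x y : List R} (h : x.Perm y) :
    treeSum t a b l x = treeSum t a b l y := by
  induction l generalizing x y with
  | zero => rfl
  | succ l ih =>
    refine List.Perm.eq_of_append_swap (f := treeSum t a b (l + 1)) (fun u p q v => ?_) h
    obtain ⟨A, B, hAB⟩ := isAffine_treeSum t a b l (1 :: u.map (a * ·)) (v.map (b * ·))
    simp only [List.cons_append] at hAB
    simp only [treeSum, splitSum_append, splitSum]
    congr 1
    · congr 1
      exact ih (((List.Perm.swap q p v).append_left u).cons 1)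
    congr 1
    · congr 1
      funext u' r w
      congr 1
      apply ih
      simp only [List.map_append, List.map_cons]
      exact ((((List.Perm.swap _ _ _).append_left _).append_left _).cons 1)
    rw [← add_assoc, ← add_assoc]
    congr 1
    · simp only [List.append_nil, List.map_append, List.map_cons, List.map_nil, List.append_assoc,
        List.cons_append, List.nil_append, hAB]
      ring
    · congr 1
      funext u' r w
      congr 1
      apply ih
      simp only [List.map_append, List.map_cons]
      exact ((((List.Perm.swap _ _ _).append_left _).append_right _).cons 1)

theorem treeSum_comm (l : ℕ) (x : List R) : treeSum t a b l x = treeSum t b a l x := by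
  induction l generalizing x with
  | zero => rfl
  | succ l ih =>
    rw [treeSum_perm t b a _ x.reverse_perm.symm, treeSum, treeSum, splitSum_reverse, ih,
      treeSum_perm t b a l (x.reverse_perm.cons 1)]
    congr 2
    funext u p w
    rw [ih, List.map_reverse, List.map_reverse, ← List.reverse_append]
    exact congrArg _ (treeSum_perm t b a l ((List.reverse_perm _).cons 1).symm)

theorem treeSum_one (x : List R) :
    treeSum t a b 1 x = t + x.sum := by
  simp only [treeSum, mul_one]
  rw [splitSum_eq_sum (fun _ p _ => p) id x fun _ _ _ _ => rfl, List.map_id]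

end TreeSum

section Blocks

variable {n : ℕ} {p : SetPartition n}

theorem inSameBlock_iff_part_eq {i j : Fin n} : InSameBlock p i j ↔ p.part i = p.part j := by
  rw [← p.mem_part_iff_part_eq_part (mem_univ _) (mem_univ _), Finpartition.mem_part_iff_exists]
  rfl

theorem isArc_iff {i j : Fin n} : IsArc p i j ↔
    i < j ∧ InSameBlock p i j ∧ ∀ x, InSameBlock p i x → ¬ (i < x ∧ x < j) := by
  refine and_congr_right fun _ => ⟨?_, ?_⟩
  · rintro ⟨B, hB, hi, hj, h⟩
    refine ⟨⟨B, hB, hi, hj⟩, ?_⟩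
    rintro x ⟨C, hC, hiC, hx⟩
    exact h x (p.eq_of_mem_parts hC hB hiC hi ▸ hx)
  · rintro ⟨⟨B, hB, hi, hj⟩, h⟩
    exact ⟨B, hB, hi, hj, fun x hx => h x ⟨B, hB, hi, hx⟩⟩

theorem setPartition_ext {q : SetPartition n}
    (h : ∀ i j, InSameBlock p i j ↔ InSameBlock q i j) : p = q := by
  have hpart : ∀ i, p.part i = q.part i := fun i => by
    ext j
    rw [Finpartition.mem_part_iff_exists, Finpartition.mem_part_iff_exists]
    exact h j i
  have hle : ∀ {r s : SetPartition n}, (∀ i, r.part i = s.part i) → r.parts ⊆ s.parts := by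
    intro r s hrs B hB
    obtain ⟨i, hi⟩ := r.nonempty_of_mem_parts hB
    rw [← r.part_eq_of_mem hB hi, hrs]
    exact s.part_mem.2 (mem_univ _)
  exact Finpartition.ext (Subset.antisymm (hle hpart) (hle fun i => (hpart i).symm))

end Blocks

/-- The element `i` is the minimum of its block. -/
def IsOpener {n : ℕ} (p : SetPartition n) (i : Fin n) : Prop :=
  ∀ j < i, ¬ InSameBlock p i j

open Classical in
/-- The block minima of a set partition, in increasing order. -/
noncomputable def openers {n : ℕ} (p : SetPartition n) : List (Fin n) :=
  (List.finRange n).filter fun i => IsOpener p i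

open Classical in
/-- The set of arcs of a set partition. -/
noncomputable def arcs {n : ℕ} (p : SetPartition n) : Finset (Fin n × Fin n) :=
  {e | IsArc p e.1 e.2}

/-- The number of arcs passing strictly above `i`. -/
noncomputable def numOver {n : ℕ} (p : SetPartition n) (i : Fin n) : ℕ :=
  ∑ e ∈ arcs p, if e.1 < i ∧ i < e.2 then 1 else 0

/-- The number of arcs lying strictly to the left of `i`. -/
noncomputable def numLeft {n : ℕ} (p : SetPartition n) (i : Fin n) : ℕ :=
  ∑ e ∈ arcs p, if e.2 < i then 1 else 0

/-- The change of `statS α β` when a new first element is joined to the block with minimum `i`. -/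
noncomputable def joinWeight {G : Type*} [AddCommGroup G] (α β : G) {n : ℕ} (p : SetPartition n)
    (i : Fin n) : G :=
  numOver p i • α + numLeft p i • β

/-- The child of `p` in which the new first element is a singleton, if `o = none`, or lies in the
block of `i`, if `o = some i`. -/
noncomputable def child {n : ℕ} (p : SetPartition n) (o : Option (Fin n)) : SetPartition (n + 1) :=
  letI := Classical.decRel (Setoid.ker (Fin.cons (α := fun _ => Option (Finset (Fin n)))
    (o.map p.part) fun j => some (p.part j))).r
  Finpartition.ofSetoid (Setoid.ker (Fin.cons (α := fun _ => Option (Finset (Fin n)))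
    (o.map p.part) fun j => some (p.part j)))

section Child

variable {n : ℕ} {p : SetPartition n}

theorem mem_arcs {e : Fin n × Fin n} : e ∈ arcs p ↔ IsArc p e.1 e.2 := by
  simp [arcs]

theorem mem_openers {i : Fin n} : i ∈ openers p ↔ IsOpener p i := by
  simp [openers]

theorem inSameBlock_comm {i j : Fin n} : InSameBlock p i j ↔ InSameBlock p j i := by
  simp only [inSameBlock_iff_part_eq, eq_comm]

theorem inSameBlock_child {o : Option (Fin n)} {a b : Fin (n + 1)} :
    InSameBlock (child p o) a b ↔
      Fin.cons (α := fun _ => Option (Finset (Fin n))) (o.map p.part) (fun j => some (p.part j)) a =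
      Fin.cons (α := fun _ => Option (Finset (Fin n))) (o.map p.part) (fun j => some (p.part j)) b
        := by
  let _ := Classical.decRel (Setoid.ker (Fin.cons (α := fun _ => Option (Finset (Fin n)))
    (o.map p.part) fun j => some (p.part j))).r
  rw [inSameBlock_iff_part_eq, eq_comm,
    ← Finpartition.mem_part_iff_part_eq_part _ (mem_univ _) (mem_univ _), child,
    Finpartition.mem_part_ofSetoid_iff_rel, Setoid.ker_def, eq_comm]

@[simp]
theorem inSameBlock_child_succ {o : Option (Fin n)} {i j : Fin n} :
    InSameBlock (child p o) i.succ j.succ ↔ InSameBlock p i j := by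
  rw [inSameBlock_child, inSameBlock_iff_part_eq]
  simp

@[simp]
theorem inSameBlock_child_none_zero {j : Fin n} : ¬ InSameBlock (child p none) 0 j.succ := by
  simp [inSameBlock_child]

@[simp]
theorem inSameBlock_child_some_zero {i j : Fin n} :
    InSameBlock (child p (some i)) 0 j.succ ↔ InSameBlock p i j := by
  rw [inSameBlock_child, inSameBlock_iff_part_eq]
  simp

theorem isChild_child (o : Option (Fin n)) : IsChild (child p o) p :=
  fun _ _ => inSameBlock_child_succ.symm

theorem IsChild.unique {c : SetPartition (n + 1)} {q : SetPartition n} (hp : IsChild c p)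
    (hq : IsChild c q) : p = q :=
  setPartition_ext fun i j => (hp i j).trans (hq i j).symm

theorem IsChild.ext {c d : SetPartition (n + 1)} (hc : IsChild c p) (hd : IsChild d p)
    (h : ∀ j : Fin n, InSameBlock c 0 j.succ ↔ InSameBlock d 0 j.succ) : c = d := by
  refine setPartition_ext fun a b => ?_
  induction a using Fin.cases with
  | zero =>
    induction b using Fin.cases with
    | zero => simp [inSameBlock_iff_part_eq]
    | succ b => exact h b
  | succ a =>
    induction b using Fin.cases with
    | zero => rw [inSameBlock_comm, h, inSameBlock_comm]
    | succ b => rw [← hc, hd]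

theorem exists_opener (i : Fin n) : ∃ m, IsOpener p m ∧ InSameBlock p m i := by
  induction i using WellFoundedLT.induction with
  | ind i ih =>
    by_cases h : IsOpener p i
    · exact ⟨i, h, by simp [inSameBlock_iff_part_eq]⟩
    · simp only [IsOpener, not_forall, not_not] at h
      obtain ⟨j, hj, hij⟩ := h
      obtain ⟨m, hm, hmj⟩ := ih j hj
      rw [inSameBlock_iff_part_eq] at hij hmj
      exact ⟨m, hm, inSameBlock_iff_part_eq.2 (hmj.trans hij.symm)⟩

theorem IsOpener.eq_of_inSameBlock {i j : Fin n} (hi : IsOpener p i) (hj : IsOpener p j)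
    (h : InSameBlock p i j) : i = j := by
  rcases lt_trichotomy i j with hij | hij | hij
  · exact absurd (inSameBlock_comm.1 h) (hj i hij)
  · exact hij
  · exact absurd h (hi j hij)

theorem isChild_iff {c : SetPartition (n + 1)} :
    IsChild c p ↔ c = child p none ∨ ∃ i, IsOpener p i ∧ c = child p (some i) := by
  refine ⟨fun hc => ?_, ?_⟩
  · by_cases h : ∃ j : Fin n, InSameBlock c 0 j.succ
    · obtain ⟨j, hj⟩ := h
      obtain ⟨i, hi, hij⟩ := exists_opener (p := p) j
      refine Or.inr ⟨i, hi, hc.ext (isChild_child _) fun k => ?_⟩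
      rw [inSameBlock_child_some_zero]
      have hjk := hc j k
      simp only [inSameBlock_iff_part_eq] at hj hij hjk ⊢
      rw [hj, hij, hjk]
    · push Not at h
      exact Or.inl (hc.ext (isChild_child _) fun k => by simp [h k])
  · rintro (rfl | ⟨i, -, rfl⟩) <;> exact isChild_child _

theorem isOpener_child_zero (o : Option (Fin n)) : IsOpener (child p o) 0 :=
  fun j hj => absurd hj (Fin.not_lt_zero j)

theorem isOpener_child_succ {o : Option (Fin n)} {j : Fin n} :
    IsOpener (child p o) j.succ ↔ IsOpener p j ∧ ¬ InSameBlock (child p o) 0 j.succ := by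
  refine ⟨fun h => ⟨fun k hk hjk => h k.succ (Fin.succ_lt_succ_iff.2 hk)
    (inSameBlock_child_succ.2 hjk), fun h0 => h 0 j.succ_pos (inSameBlock_comm.1 h0)⟩, ?_⟩
  rintro ⟨h, h0⟩ k hk
  induction k using Fin.cases with
  | zero => rwa [inSameBlock_comm]
  | succ k => exact fun hjk => h k (Fin.succ_lt_succ_iff.1 hk) (inSameBlock_child_succ.1 hjk)

theorem openers_child_none : openers (child p none) = 0 :: (openers p).map Fin.succ := by
  classical
  rw [openers, List.finRange_succ, List.filter_cons_of_pos (by simpa using isOpener_child_zero _),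
    List.filter_map, openers]
  congr 2
  exact List.filter_congr fun j _ => by simp [isOpener_child_succ]

theorem openers_child_some {i : Fin n} (hi : IsOpener p i) {u w : List (Fin n)}
    (h : openers p = u ++ i :: w) :
    openers (child p (some i)) = 0 :: (u ++ w).map Fin.succ := by
  classical
  have hnd : (openers p).Nodup := (List.nodup_finRange n).filter _
  have hfilter : (openers p).filter (fun j => j ≠ i) = u ++ w := by
    rw [h, List.nodup_append] at hnd
    obtain ⟨-, hiw, hu⟩ := hnd
    rw [h, List.filter_append, List.filter_cons_of_neg (by simp), List.filter_eq_self.2,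
      List.filter_eq_self.2]
    · intro j hj
      exact decide_eq_true (ne_of_mem_of_not_mem hj (List.nodup_cons.1 hiw).1)
    · intro j hj
      simpa using hu j hj i (by simp)
  rw [openers, List.finRange_succ, List.filter_cons_of_pos (by simpa using isOpener_child_zero _),
    List.filter_map, ← hfilter, openers, List.filter_filter]
  congr 2
  refine List.filter_congr fun j _ => ?_
  simp only [Function.comp_apply, isOpener_child_succ, inSameBlock_child_some_zero, ne_eq,
    ← Bool.decide_and, decide_eq_decide]
  rw [and_comm]
  refine and_congr_left fun hj => not_congr ⟨fun hij => (hi.eq_of_inSameBlock hj hij).symm, ?_⟩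
  rintro rfl
  simp [inSameBlock_iff_part_eq]

theorem isArc_child_succ {o : Option (Fin n)} {i j : Fin n} :
    IsArc (child p o) i.succ j.succ ↔ IsArc p i j := by
  simp only [isArc_iff, Fin.succ_lt_succ_iff, inSameBlock_child_succ, Fin.forall_fin_succ,
    Fin.not_lt_zero, false_and, not_false_eq_true, implies_true, true_and]

theorem not_isArc_zero_right {c : SetPartition (n + 1)} {a : Fin (n + 1)} : ¬ IsArc c a 0 :=
  fun h => absurd h.1 (Fin.not_lt_zero a)

theorem isArc_child_some_zero {i j : Fin n} (hi : IsOpener p i) :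
    IsArc (child p (some i)) 0 j.succ ↔ j = i := by
  simp only [isArc_iff, Fin.succ_pos, inSameBlock_child_some_zero, Fin.forall_fin_succ,
    Fin.succ_lt_succ_iff, lt_irrefl, true_and, false_and, not_false_eq_true, implies_true]
  refine ⟨fun ⟨hij, h⟩ => ?_, ?_⟩
  · rcases lt_trichotomy i j with hlt | heq | hgt
    · exact absurd hlt (h i (by simp [inSameBlock_iff_part_eq]))
    · exact heq.symm
    · exact absurd hij (hi j hgt)
  · rintro rfl
    exact ⟨by simp [inSameBlock_iff_part_eq], fun k hk hkj => hi k hkj hk⟩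

/-- The map on pairs of elements induced by the shift by one. -/
def succPair (n : ℕ) : Fin n × Fin n ↪ Fin (n + 1) × Fin (n + 1) :=
  (Fin.succEmb n).prodMap (Fin.succEmb n)

@[simp]
theorem succPair_apply (e : Fin n × Fin n) : succPair n e = (e.1.succ, e.2.succ) := rfl

theorem arcs_child_none : arcs (child p none) = (arcs p).map (succPair n) := by
  ext ⟨a, b⟩
  simp only [mem_arcs, mem_map, succPair_apply, Prod.exists, Prod.mk.injEq]
  induction a using Fin.cases with
  | zero =>
    induction b using Fin.cases with
    | zero => simp [not_isArc_zero_right]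
    | succ b => simp [isArc_iff]
  | succ a =>
    induction b using Fin.cases with
    | zero => simp [not_isArc_zero_right]
    | succ b => simp [isArc_child_succ]

theorem arcs_child_some {i : Fin n} (hi : IsOpener p i) :
    arcs (child p (some i)) = insert (0, i.succ) ((arcs p).map (succPair n)) := by
  ext ⟨a, b⟩
  simp only [mem_arcs, mem_insert, mem_map, succPair_apply, Prod.exists, Prod.mk.injEq]
  induction a using Fin.cases with
  | zero =>
    induction b using Fin.cases with
    | zero => simp [not_isArc_zero_right, (Fin.succ_ne_zero _).symm]
    | succ b => simp [isArc_child_some_zero hi]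
  | succ a =>
    induction b using Fin.cases with
    | zero => simp [not_isArc_zero_right]
    | succ b => simp [isArc_child_succ]

theorem zero_notMem_map_succPair (i : Fin (n + 1)) (s : Finset (Fin n × Fin n)) :
    ((0, i) : Fin (n + 1) × Fin (n + 1)) ∉ s.map (succPair n) := by
  simp

theorem cr_eq_sum : cr p = ∑ e ∈ arcs p, ∑ f ∈ arcs p,
    if e.1 < f.1 ∧ f.1 < e.2 ∧ e.2 < f.2 then 1 else 0 := by
  rw [← sum_product', ← card_filter, cr, ← Set.ncard_coe_finset]
  congr 1
  ext e
  simp [mem_arcs, and_assoc, Crossing]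

theorem ne'_eq_sum : ne' p = ∑ e ∈ arcs p, ∑ f ∈ arcs p,
    if e.1 < f.1 ∧ f.1 < f.2 ∧ f.2 < e.2 then 1 else 0 := by
  rw [← sum_product', ← card_filter, ne', ← Set.ncard_coe_finset]
  congr 1
  ext e
  simp [mem_arcs, and_assoc, Nesting]

theorem cr_child_none : cr (child p none) = cr p := by
  simp [-sum_boole, cr_eq_sum, arcs_child_none]

theorem ne'_child_none : ne' (child p none) = ne' p := by
  simp [-sum_boole, ne'_eq_sum, arcs_child_none]

theorem numOver_child_none (j : Fin n) : numOver (child p none) j.succ = numOver p j := by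
  simp [-sum_boole, numOver, arcs_child_none]

theorem numLeft_child_none (j : Fin n) : numLeft (child p none) j.succ = numLeft p j := by
  simp [-sum_boole, numLeft, arcs_child_none]

theorem cr_child_some {i : Fin n} (hi : IsOpener p i) :
    cr (child p (some i)) = cr p + numOver p i := by
  simp [-sum_boole, cr_eq_sum, numOver, arcs_child_some hi, sum_insert
    (zero_notMem_map_succPair _ _),
    add_comm]

theorem ne'_child_some {i : Fin n} (hi : IsOpener p i) :
    ne' (child p (some i)) = ne' p + numLeft p i := by
  have h : ∀ e ∈ arcs p, (e.1 < e.2 ∧ e.2 < i ↔ e.2 < i) := fun e he =>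
    and_iff_right (mem_arcs.1 he).1
  simp only [ne'_eq_sum, numLeft, arcs_child_some hi, sum_insert
    (zero_notMem_map_succPair _ _),
    sum_map, succPair_apply, Fin.succ_pos, Fin.succ_lt_succ_iff, Fin.not_lt_zero,
    false_and, true_and, if_false, zero_add]
  rw [add_comm]
  congr 1
  exact sum_congr rfl fun e he => if_congr (h e he) rfl rfl

theorem numOver_child_some {i : Fin n} (hi : IsOpener p i) (j : Fin n) :
    numOver (child p (some i)) j.succ = numOver p j + if j < i then 1 else 0 := by
  simp [-sum_boole, numOver, arcs_child_some hi, sum_insert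
    (zero_notMem_map_succPair _ _), add_comm]

theorem numLeft_child_some {i : Fin n} (hi : IsOpener p i) (j : Fin n) :
    numLeft (child p (some i)) j.succ = numLeft p j + if i < j then 1 else 0 := by
  simp [-sum_boole, numLeft, arcs_child_some hi, sum_insert
    (zero_notMem_map_succPair _ _), add_comm]

theorem card_parts_eq_length_openers : p.parts.card = (openers p).length := by
  classical
  have hnd : (openers p).Nodup := (List.nodup_finRange n).filter _
  rw [← List.toFinset_card_of_nodup hnd]
  symm
  refine card_bij (fun i _ => p.part i) (fun i _ => p.part_mem.2 (mem_univ _)) ?_ ?_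
  · intro i hi j hj h
    rw [List.mem_toFinset, mem_openers] at hi hj
    exact hi.eq_of_inSameBlock hj (inSameBlock_iff_part_eq.2 h)
  · intro B hB
    obtain ⟨i, hi⟩ := p.nonempty_of_mem_parts hB
    obtain ⟨m, hm, hmi⟩ := exists_opener (p := p) i
    rw [inSameBlock_iff_part_eq] at hmi
    exact ⟨m, by simpa [mem_openers] using hm, hmi.trans (p.part_eq_of_mem hB hi)⟩

end Child

theorem lt_and_lt_of_openers_eq {n : ℕ} {p : SetPartition n} {i : Fin n} {u w : List (Fin n)}
    (h : openers p = u ++ i :: w) : (∀ j ∈ u, j < i) ∧ ∀ j ∈ w, i < j := by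
  have hs : (openers p).Pairwise (· < ·) := (List.pairwise_lt_finRange n).filter _
  rw [h, List.pairwise_append, List.pairwise_cons] at hs
  exact ⟨fun j hj => hs.2.2 j hj i (by simp), hs.2.1.1⟩

theorem mem_level_zero {n : ℕ} {p c : SetPartition n} : c ∈ level p 0 ↔ c = p := Iff.rfl

theorem mem_level_succ {n l : ℕ} {p : SetPartition n} {c : SetPartition (n + l + 1)} :
    c ∈ level p (l + 1) ↔ ∃ q ∈ level p l, IsChild c q := Iff.rfl

section Weights

variable {G R : Type*} [AddCommGroup G] [CommSemiring R] (φ : Multiplicative G →* R) (t : R)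
  (α β : G) {n : ℕ} (p : SetPartition n)

/-- The contribution of `p` to the generating function of `statS α β` and the number of blocks. -/
noncomputable def partitionWeight : R :=
  φ (.ofAdd (statS α β p)) * t ^ p.parts.card

/-- The list of the values `joinWeight α β p i`, for the block minima `i` of `p`. -/
noncomputable def joinWeights : List G :=
  (openers p).map (joinWeight α β p)

variable {p}

theorem joinWeight_zero {c : SetPartition (n + 1)} : joinWeight α β c 0 = 0 := by
  simp [joinWeight, numOver, numLeft]

theorem joinWeights_child_none : joinWeights α β (child p none) = 0 :: joinWeights α β p := by
  simp only [joinWeights, openers_child_none, List.map_cons, joinWeight_zero, List.map_map]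
  congr 2
  funext j
  simp [joinWeight, numOver_child_none, numLeft_child_none]

theorem joinWeights_child_some {i : Fin n} (hi : IsOpener p i) {u w : List (Fin n)}
    (h : openers p = u ++ i :: w) :
    joinWeights α β (child p (some i)) = 0 :: ((u.map (joinWeight α β p)).map (α + ·) ++
      (w.map (joinWeight α β p)).map (β + ·)) := by
  obtain ⟨hu, hw⟩ := lt_and_lt_of_openers_eq h
  simp only [joinWeights, openers_child_some hi h, List.map_cons, joinWeight_zero, List.map_append,
    List.map_map]
  congr 2
  · refine List.map_congr_left fun j hj => ?_
    simp only [Function.comp_apply, joinWeight, numOver_child_some hi, numLeft_child_some hi,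
      hu j hj, (hu j hj).not_gt, if_true, if_false, add_smul, one_smul, zero_smul]
    abel
  · refine List.map_congr_left fun j hj => ?_
    simp only [Function.comp_apply, joinWeight, numOver_child_some hi, numLeft_child_some hi,
      hw j hj, (hw j hj).not_gt, if_true, if_false, add_smul, one_smul, zero_smul]
    abel

theorem statS_child_none : statS α β (child p none) = statS α β p := by
  simp [statS, cr_child_none, ne'_child_none]

theorem statS_child_some {i : Fin n} (hi : IsOpener p i) :
    statS α β (child p (some i)) = statS α β p + joinWeight α β p i := by
  simp only [statS, cr_child_some hi, ne'_child_some hi, joinWeight, add_smul]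
  abel

theorem partitionWeight_child_none :
    partitionWeight φ t α β (child p none) = partitionWeight φ t α β p * t := by
  simp [partitionWeight, statS_child_none, card_parts_eq_length_openers, openers_child_none,
    pow_succ, mul_assoc]

theorem partitionWeight_child_some {i : Fin n} (hi : IsOpener p i) :
    partitionWeight φ t α β (child p (some i)) =
      partitionWeight φ t α β p * φ (.ofAdd (joinWeight α β p i)) := by
  obtain ⟨u, w, h⟩ := List.append_of_mem (mem_openers.2 hi)
  have hcard : (child p (some i)).parts.card = p.parts.card := by
    simp only [card_parts_eq_length_openers, openers_child_some hi h, h, List.length_cons,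
      List.length_map, List.length_append]
    omega
  rw [partitionWeight, partitionWeight, statS_child_some α β hi, hcard, ofAdd_add, map_mul]
  ring

open Classical in
theorem sum_children (l : ℕ) :
    ∑ c with IsChild c p, partitionWeight φ t α β c *
        treeSum t (φ (.ofAdd α)) (φ (.ofAdd β)) l
          ((joinWeights α β c).map fun g => φ (.ofAdd g)) =
      partitionWeight φ t α β p * treeSum t (φ (.ofAdd α)) (φ (.ofAdd β)) (l + 1)
        ((joinWeights α β p).map fun g => φ (.ofAdd g)) := by
  have hnd : (openers p).Nodup := (List.nodup_finRange n).filter _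
  have hchildren : ({c | IsChild c p} : Finset (SetPartition (n + 1))) =
      insert (child p none) ((openers p).toFinset.image fun i => child p (some i)) := by
    ext c
    simp [isChild_iff, mem_openers, eq_comm]
  have hnone : child p none ∉ (openers p).toFinset.image fun i => child p (some i) := by
    simp only [mem_image, not_exists, not_and]
    intro i _ h
    have := inSameBlock_child_some_zero (p := p) (i := i) (j := i)
    rw [h] at this
    exact inSameBlock_child_none_zero (this.2 (inSameBlock_iff_part_eq.2 rfl))
  have hinj : Set.InjOn (fun i => child p (some i)) (openers p).toFinset := by
    intro i hi j hj h
    simp only [List.coe_toFinset, Set.mem_ofPred_eq, mem_openers] at hi hj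
    refine hi.eq_of_inSameBlock hj ?_
    rw [← inSameBlock_child_some_zero, show child p (some i) = child p (some j) from h,
      inSameBlock_child_some_zero, inSameBlock_iff_part_eq]
  rw [hchildren, sum_insert hnone, sum_image hinj, List.sum_toFinset _ hnd, treeSum, mul_add]
  congr 1
  · simp only [partitionWeight_child_none, joinWeights_child_none, List.map_cons, ofAdd_zero,
      map_one, mul_assoc]
  · rw [joinWeights, splitSum_map, splitSum_map, splitSum_eq_sum _
      (fun i => φ (.ofAdd (joinWeight α β p i)) * treeSum t (φ (.ofAdd α)) (φ (.ofAdd β)) l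
        ((joinWeights α β (child p (some i))).map fun g => φ (.ofAdd g))), ← List.sum_map_mul_left]
    · refine congrArg List.sum (List.map_congr_left fun i hi => ?_)
      rw [partitionWeight_child_some φ t α β (mem_openers.1 hi), mul_assoc]
    · intro u i w h
      rw [joinWeights_child_some α β (mem_openers.1 (by simp [h])) h]
      simp [Function.comp_def]

open Classical in
theorem sum_level (p : SetPartition n) (l k : ℕ) :
    ∑ c with c ∈ level p l, partitionWeight φ t α β c *
        treeSum t (φ (.ofAdd α)) (φ (.ofAdd β)) k
          ((joinWeights α β c).map fun g => φ (.ofAdd g)) =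
      partitionWeight φ t α β p * treeSum t (φ (.ofAdd α)) (φ (.ofAdd β)) (l + k)
        ((joinWeights α β p).map fun g => φ (.ofAdd g)) := by
  induction l generalizing k with
  | zero =>
    have hlevel : ({c | c ∈ level p 0} : Finset (SetPartition n)) = {p} := by
      ext c
      simp [mem_level_zero]
    refine (sum_congr hlevel fun _ _ => rfl).trans ?_
    rw [sum_singleton, zero_add]
  | succ l ih =>
    have hlevel : ({c | c ∈ level p (l + 1)} : Finset (SetPartition (n + l + 1))) =
        ({q | q ∈ level p l} : Finset (SetPartition (n + l))).biUnion
          fun q => {c | IsChild c q} := by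
      ext c
      simp [mem_level_succ]
    refine (sum_congr hlevel fun _ _ => rfl).trans ?_
    rw [sum_biUnion]
    · simp only [sum_children]
      rw [ih, add_right_comm, add_assoc]
    · intro q _ r _ hqr
      refine disjoint_left.2 fun c hq hr => hqr ?_
      simp only [mem_filter, mem_univ, true_and] at hq hr
      exact hq.unique hr

open Classical in
theorem sum_level_partitionWeight (p : SetPartition n) (l : ℕ) :
    ∑ c with c ∈ level p l, partitionWeight φ t α β c =
      partitionWeight φ t α β p * treeSum t (φ (.ofAdd α)) (φ (.ofAdd β)) l
        ((joinWeights α β p).map fun g => φ (.ofAdd g)) := by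
  simpa [treeSum] using sum_level φ t α β p l 0

end Weights

section GenFun

variable {M : Type*}

open Classical in
theorem coeff_sum_single {ι : Type*} (s : Finset ι) (f : ι → M) (k : M) :
    (∑ x ∈ s, AddMonoidAlgebra.single (f x) (1 : ℕ)).coeff k = #{x ∈ s | f x = k} := by
  rw [AddMonoidAlgebra.coeff_sum, Finsupp.finsetSum_apply, card_filter]
  exact sum_congr rfl fun x _ => Finsupp.single_apply

theorem List.perm_of_sum_single_eq {x y : List M}
    (h : (x.map fun g => AddMonoidAlgebra.single g (1 : ℕ)).sum =
      (y.map fun g => AddMonoidAlgebra.single g (1 : ℕ)).sum) : x.Perm y := by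
  classical
  have key : ∀ (z : List M) (k : M),
      (z.map fun g => AddMonoidAlgebra.single g (1 : ℕ)).sum.coeff k = z.count k := by
    intro z k
    induction z with
    | nil => simp
    | cons g z ih =>
      simp [ih, Finsupp.single_apply, List.count_cons, add_comm]
  exact List.perm_iff_count.2 fun k => by rw [← key, h, key]

end GenFun

open Classical in
theorem ncard_sep_eq_coeff {M : Type*} {n : ℕ} (s : Set (SetPartition n))
    (f : SetPartition n → M) (k : M) :
    {c ∈ s | f c = k}.ncard =
      (∑ c with c ∈ s, AddMonoidAlgebra.single (f c) (1 : ℕ)).coeff k := by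
  rw [coeff_sum_single, ← Set.ncard_coe_finset]
  congr 1
  ext c
  simp

theorem sum_single_eq_iff {M : Type*} {n n' : ℕ} {s : Set (SetPartition n)}
    {s' : Set (SetPartition n')} {f : SetPartition n → M} {f' : SetPartition n' → M}
    [DecidablePred (· ∈ s)] [DecidablePred (· ∈ s')] :
    ∑ c with c ∈ s, AddMonoidAlgebra.single (f c) (1 : ℕ) =
        ∑ c with c ∈ s', AddMonoidAlgebra.single (f' c) (1 : ℕ) ↔
      ∀ k, {c ∈ s | f c = k}.ncard = {c ∈ s' | f' c = k}.ncard := by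
  simp only [ncard_sep_eq_coeff]
  refine ⟨fun h k => ?_, fun h => ?_⟩
  · convert congrArg (fun z => AddMonoidAlgebra.coeff z k) h
  · ext k
    convert h k

/-- The inclusion of `G` into the semiring `ℕ[G × ℕ]`. -/
noncomputable def inlHom (G : Type*) [AddCommGroup G] :
    Multiplicative G →* AddMonoidAlgebra ℕ (G × ℕ) :=
  (AddMonoidAlgebra.of ℕ (G × ℕ)).comp (AddMonoidHom.toMultiplicative (AddMonoidHom.inl G ℕ))

theorem partitionWeight_inlHom {G : Type*} [AddCommGroup G] (α β : G) {n : ℕ}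
    (p : SetPartition n) :
    partitionWeight (inlHom G) (AddMonoidAlgebra.single (0, 1) 1) α β p =
      AddMonoidAlgebra.single (statS α β p, p.parts.card) 1 := by
  simp [inlHom, partitionWeight, AddMonoidAlgebra.single_pow, AddMonoidAlgebra.single_mul_single]

theorem perm_joinWeights {G : Type*} [AddCommGroup G] (α β : G) {n n' : ℕ}
    (lam : SetPartition n) (pi : SetPartition n')
    (hs : statS α β lam = statS β α pi)
    (h : ∀ g : G,
      {t ∈ level lam 1 | statS α β t = g}.ncard =
      {t ∈ level pi 1 | statS β α t = g}.ncard) :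
    (joinWeights α β lam).Perm (joinWeights β α pi) := by
  classical
  have hW : ∀ (γ δ : G) {m : ℕ} (p : SetPartition m),
      partitionWeight (AddMonoidAlgebra.of ℕ G) 1 γ δ p =
        AddMonoidAlgebra.single (statS γ δ p) 1 := by simp [partitionWeight]
  have h1 := sum_single_eq_iff.2 h
  simp only [← hW] at h1
  rw [sum_level_partitionWeight, sum_level_partitionWeight, hW, hW, hs, treeSum_one,
    treeSum_one] at h1
  replace h1 := congrArg (AddMonoidAlgebra.single (-statS β α pi) 1 * ·) h1
  simp only [← mul_assoc, AddMonoidAlgebra.single_mul_single, neg_add_cancel, mul_one] at h1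
  rw [← AddMonoidAlgebra.one_def, one_mul, one_mul] at h1
  refine List.perm_of_sum_single_eq ?_
  ext k
  have := congrArg (fun z => AddMonoidAlgebra.coeff z k) h1
  simpa using this

/-- Theorem 1.1(b). If the multiset of values of `s_{α,β}` on levels `0`
and `1` of the tree rooted at `lam` agrees with that of `s_{β,α}` on the tree rooted at
`pi`, then `s_{α,β}` on `T(lam,l,m)` agrees with `s_{β,α}` on `T(pi,l,m)` for all
`l, m ≥ 0`. Multiset equality is expressed by equality of the number of elements attaining
each value `g : G`. -/
theorem statement1 {G : Type*} [AddCommGroup G] (α β : G) {n n' : ℕ}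
    (hn : 0 < n) (hn' : 0 < n') (lam : SetPartition n) (pi : SetPartition n')
    (h : ∀ l ≤ 1, ∀ g : G,
      {t ∈ level lam l | statS α β t = g}.ncard =
      {t ∈ level pi l | statS β α t = g}.ncard) :
    ∀ l m : ℕ, ∀ g : G,
      {t ∈ level lam l | t.parts.card = m ∧ statS α β t = g}.ncard =
      {t ∈ level pi l | t.parts.card = m ∧ statS β α t = g}.ncard := by
  classical
  have h0 : statS α β lam = statS β α pi := by
    by_contra hne
    have hlam : {t ∈ level lam 0 | statS α β t = statS α β lam} = {lam} :=
      Set.ext fun c => ⟨fun hc => hc.1, fun hc => ⟨hc, congrArg _ (mem_level_zero.1 hc)⟩⟩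
    have hpi : {t ∈ level pi 0 | statS β α t = statS α β lam} = ∅ :=
      Set.eq_empty_of_forall_notMem fun c hc => hne (mem_level_zero.1 hc.1 ▸ hc.2.symm)
    have hncard := (congrArg Set.ncard hlam).symm.trans
      ((h 0 zero_le_one (statS α β lam)).trans (congrArg Set.ncard hpi))
    simp at hncard
  have hperm := perm_joinWeights α β lam pi h0 (h 1 le_rfl)
  have hcard : lam.parts.card = pi.parts.card := by
    simpa [joinWeights, card_parts_eq_length_openers] using hperm.length_eq
  intro l m g
  have hsum := sum_level_partitionWeight (inlHom G) (AddMonoidAlgebra.single (0, 1) 1) α β lam l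
  rw [treeSum_perm _ _ _ _ (hperm.map _), treeSum_comm, partitionWeight, h0, hcard,
    ← partitionWeight, ← sum_level_partitionWeight] at hsum
  simp only [partitionWeight_inlHom] at hsum
  simpa [and_comm] using sum_single_eq_iff.1 hsum (g, m)
end

section
/- Let G be an abelian group, let α, β ∈ G, and let X and Y be finite multisets of finite nonempty sequences over G such that f_γ^r(X) = f_γ^r(Y) for every integer r ≥ 0 and every γ ∈ G. Then f_γ^r(R_{α,β}(X)) = f_γ^r(R_{β,α}(Y)) for every r ≥ 0 and every γ ∈ G. -/
variable {G : Type*} [AddCommGroup G]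

/-- `f_γ^r(x₁…x_l)`: the multiset
`{x_{a₁} + ⋯ + x_{a_r} − (r−1)x₁ + γ : 1 < a₁ < ⋯ < a_r ≤ l}`, with one element for each
choice of `r` positions strictly after the first. -/
def fStat (γ : G) (r : ℕ) (w : List G) : Multiset G :=
  ((w.tail.sublistsLen r).map fun c => c.sum - ((r : ℤ) - 1) • w.headD 0 + γ : List G)

/-- The extension of `f_γ^r` to finite multisets of sequences, adding multiplicities. -/
def fStatM (γ : G) (r : ℕ) (X : Multiset (List G)) : Multiset G :=
  X.bind (fStat γ r)

/-- The operator `M(x₁x₂…x_l) = x₁x₁x₂…x_l`. -/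
def Mop : List G → List G
  | [] => []
  | x :: t => x :: x :: t

/-- The extension of `M` to finite multisets of sequences. -/
def MopM (X : Multiset (List G)) : Multiset (List G) :=
  X.map Mop

/-- `R_{α,β,i}` (here `i` is 0-indexed: `RopAt α β w i` with `0 ≤ i < l` is
`R_{α,β,i+1}(x₁…x_l) = x_{i+1}(x₁…x_i + (x_{i+1}−x₁+α))(x_{i+2}…x_l + (x_{i+1}−x₁+β))`,
where adding a group element to a sequence adds it to every term). -/
def RopAt (α β : G) (w : List G) (i : ℕ) : List G :=
  w.getD i 0 ::
    ((w.take i).map (· + (w.getD i 0 - w.headD 0 + α)) ++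
      (w.drop (i + 1)).map (· + (w.getD i 0 - w.headD 0 + β)))

/-- `R_{α,β}(w)`: the multiset `{R_{α,β,i}(w) : 1 ≤ i ≤ l}`. -/
def Rop (α β : G) (w : List G) : Multiset (List G) :=
  ((List.range w.length).map (RopAt α β w) : List (List G))

/-- The extension of `R_{α,β}` to finite multisets of sequences. -/
def RopM (α β : G) (X : Multiset (List G)) : Multiset (List G) :=
  X.bind (Rop α β)

open Finset

/-- The multiset of sums of `r` terms of `l`, one for each choice of `r` positions. -/
def sublistSums (r : ℕ) (l : List G) : Multiset G :=
  ((l.sublistsLen r).map List.sum : List G)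

theorem sublistSums_zero (l : List G) : sublistSums 0 l = {0} := by
  simp [sublistSums]

theorem sublistSums_succ_nil (r : ℕ) : sublistSums (r + 1) ([] : List G) = 0 := by
  simp [sublistSums]

theorem sublistSums_succ_cons (r : ℕ) (y : G) (l : List G) :
    sublistSums (r + 1) (y :: l) =
      sublistSums (r + 1) l + (sublistSums r l).map (· + y) := by
  simp [sublistSums, List.sublistsLen_succ_cons, Function.comp_def, add_comm y]

/-- Translating every term by `c` translates the sums of `r` terms by `r • c`. -/
theorem sublistSums_map_add (c : G) (r : ℕ) (l : List G) :
    sublistSums r (l.map (· + c)) = (sublistSums r l).map (· + r • c) := by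
  induction l generalizing r with
  | nil => cases r <;> simp [sublistSums_zero, sublistSums_succ_nil]
  | cons y l ih =>
    cases r with
    | zero => simp [sublistSums_zero]
    | succ r =>
      simp only [List.map_cons, sublistSums_succ_cons, ih, Multiset.map_add, Multiset.map_map,
        Function.comp_def]
      congr 2
      funext z
      rw [succ_nsmul]
      abel

theorem map_add_finset_sum {ι : Type*} (c : G) (s : Finset ι) (f : ι → Multiset G) :
    (∑ i ∈ s, f i).map (· + c) = ∑ i ∈ s, (f i).map (· + c) :=
  map_sum (Multiset.mapAddMonoidHom (· + c)) f s

/-- The list `l` with its `i`-th term removed, the terms before it translated by `α` and the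
terms after it by `β`. -/
def translateAround (α β : G) (l : List G) (i : ℕ) : List G :=
  (l.take i).map (· + α) ++ (l.drop (i + 1)).map (· + β)

/-- Choosing a position `i` and `r` further positions amounts to choosing `r + 1` positions and
the rank `p` of `i` among them. -/
theorem sum_sublistSums_translateAround (α β : G) (r : ℕ) (l : List G) :
    ∑ i ∈ range l.length, (sublistSums r (translateAround α β l i)).map (· + l.getD i 0) =
      ∑ p ∈ antidiagonal r, (sublistSums (r + 1) l).map (· + (p.1 • α + p.2 • β)) := by
  induction l generalizing r with
  | nil => simp [sublistSums_succ_nil]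
  | cons y l ih =>
    have hsucc (i : ℕ) :
        translateAround α β (y :: l) (i + 1) = (y + α) :: translateAround α β l i := by
      simp [translateAround]
    have hzero : translateAround α β (y :: l) 0 = l.map (· + β) := by
      simp [translateAround]
    rw [List.length_cons, sum_range_succ', hzero, sublistSums_map_add]
    simp only [hsucc, List.getD_cons_succ, List.getD_cons_zero]
    cases r with
    | zero =>
      have := ih 0
      simp only [sublistSums_zero] at this ⊢
      rw [this]
      simp [sublistSums_succ_cons, sublistSums_zero]
    | succ r =>
      have hstep : ∑ i ∈ range l.length,
          ((sublistSums r (translateAround α β l i)).map (· + (y + α))).map (· + l.getD i 0) =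
          ∑ p ∈ antidiagonal r,
            ((sublistSums (r + 1) l).map (· + y)).map (· + ((p.1 + 1) • α + p.2 • β)) := by
        have := congrArg (Multiset.map (· + (y + α))) (ih r)
        simp only [map_add_finset_sum, Multiset.map_map, Function.comp_def] at this ⊢
        convert this using 3
        · abel
        · rw [succ_nsmul]
          abel
      simp only [sublistSums_succ_cons, Multiset.map_add, sum_add_distrib]
      rw [ih, hstep, Finset.Nat.sum_antidiagonal_succ
        (f := fun p : ℕ × ℕ => ((sublistSums (r + 1) l).map (· + y)).map
          (· + (p.1 • α + p.2 • β)))]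
      simp only [Multiset.map_map, Function.comp_def, zero_nsmul, zero_add, add_assoc]
      rw [add_comm (Multiset.map _ _)]
      simp only [add_comm y]

theorem fStat_map_add_cons (γ x : G) (r : ℕ) (l : List G) :
    fStat γ r (x :: l.map (· + x)) = (sublistSums r l).map (· + (x + γ)) := by
  have : fStat γ r (x :: l.map (· + x)) =
      (sublistSums r (l.map (· + x))).map (· + (γ - ((r : ℤ) - 1) • x)) := by
    simp only [fStat, sublistSums, List.tail_cons, List.headD_cons, Multiset.map_coe,
      List.map_map, Function.comp_def]
    congr 2
    funext c
    abel
  rw [this, sublistSums_map_add, Multiset.map_map]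
  congr 1
  funext z
  simp only [Function.comp_apply, sub_smul, one_smul, natCast_zsmul]
  abel

/-- The statistics of `R_{α,β}(w)` in terms of those of `w`. -/
theorem fStatM_Rop (α β γ : G) (r : ℕ) {w : List G} (hw : w ≠ []) :
    fStatM γ r (Rop α β w) =
      ∑ p ∈ antidiagonal r,
        (fStat (γ + (p.1 • α + p.2 • β)) (r + 1) w + fStat (γ + (p.1 • α + p.2 • β)) r w) := by
  obtain ⟨x, t, rfl⟩ := List.exists_cons_of_ne_nil hw
  obtain ⟨l, rfl⟩ : ∃ l : List G, t = l.map (· + x) :=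
    ⟨t.map (· - x), by simp [Function.comp_def]⟩
  have hR : ∀ i ∈ range (0 :: l).length,
      fStat γ r (RopAt α β (x :: l.map (· + x)) i) =
        ((sublistSums r (translateAround α β (0 :: l) i)).map
          (· + (0 :: l).getD i 0)).map (· + (x + γ)) := by
    intro i hi
    have hcons : x :: l.map (· + x) = (0 :: l).map (· + x) := by simp
    have hget : ((0 :: l).map (· + x)).getD i 0 = (0 :: l).getD i 0 + x := by
      have hi' := mem_range.1 hi
      rw [List.getD_eq_getElem _ _ (by simpa using hi'), List.getD_eq_getElem _ _ hi',
        List.getElem_map]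
    have hRop : RopAt α β (x :: l.map (· + x)) i =
        ((0 :: l).getD i 0 + x) ::
          (translateAround α β (0 :: l) i).map (· + ((0 :: l).getD i 0 + x)) := by
      rw [hcons, RopAt, hget, translateAround, ← List.map_take, ← List.map_drop]
      simp only [List.map_append, List.map_map, Function.comp_def, List.map_cons, List.headD_cons]
      congr 3 <;> funext z <;> abel
    rw [hRop, fStat_map_add_cons, Multiset.map_map]
    congr 1
    funext z
    simp only [Function.comp_apply]
    abel
  have hsum : fStatM γ r (Rop α β (x :: l.map (· + x))) =
      ∑ i ∈ range (0 :: l).length, fStat γ r (RopAt α β (x :: l.map (· + x)) i) := by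
    simp only [fStatM, Rop, Multiset.bind, Multiset.join, Finset.sum, Multiset.map_coe,
      List.map_map, Function.comp_def, List.length_cons, List.length_map, range_val,
      ← Multiset.coe_range]
  rw [hsum, sum_congr rfl hR, ← map_add_finset_sum, sum_sublistSums_translateAround,
    map_add_finset_sum]
  refine sum_congr rfl fun p _ => ?_
  simp only [fStat_map_add_cons, sublistSums_succ_cons, Multiset.map_add, Multiset.map_map,
    Function.comp_def]
  congr 3 <;> funext z <;> abel

theorem fStatM_RopM (α β γ : G) (r : ℕ) {X : Multiset (List G)} (hX : ∀ w ∈ X, w ≠ []) :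
    fStatM γ r (RopM α β X) =
      ∑ p ∈ antidiagonal r,
        (fStatM (γ + (p.1 • α + p.2 • β)) (r + 1) X +
          fStatM (γ + (p.1 • α + p.2 • β)) r X) := by
  have : fStatM γ r (RopM α β X) = X.bind fun w => fStatM γ r (Rop α β w) :=
    Multiset.bind_assoc
  rw [this, Multiset.bind_congr fun w hw => fStatM_Rop α β γ r (hX w hw)]
  simp only [fStatM, ← Multiset.bind_add]
  exact Multiset.sum_map_sum_map _ _

/-- Lemma 2.3(c). If `f_γ^r(X) = f_γ^r(Y)` for all `r ≥ 0` and `γ ∈ G`,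
then `f_γ^r(R_{α,β}(X)) = f_γ^r(R_{β,α}(Y))` for all `r ≥ 0` and `γ ∈ G`. -/
theorem statement5 (α β : G) (X Y : Multiset (List G))
    (hX : ∀ w ∈ X, w ≠ []) (hY : ∀ w ∈ Y, w ≠ [])
    (h : ∀ (r : ℕ) (γ : G), fStatM γ r X = fStatM γ r Y) :
    ∀ (r : ℕ) (γ : G), fStatM γ r (RopM α β X) = fStatM γ r (RopM β α Y) := by
  intro r γ
  rw [fStatM_RopM α β γ r hX, fStatM_RopM β α γ r hY, ← Finset.Nat.sum_antidiagonal_swap]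
  simp only [h, Prod.fst_swap, Prod.snd_swap, add_comm]
end
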